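/- arXiv:1401.3063 — 2 statements merged into one kernel-verified Lean document; each statement's English description precedes it below -/
import Mathlib

section
/- For every n ≥ 2 and every unit vector e ∈ ℝ^n, there exists p ∈ ℝ^n such that no point of the line {p + s·e : s ∈ ℝ} is computably random; that is, in every direction in ℝ^n there is a line that misses every computably random point. -/
open MeasureTheory Filter

/-- The dyadic cube `Q_r(u)` in `ℝ^n`. -/
def dyadicCube (n r : ℕ) (u : Fin n → ℤ) : Set (Fin n → ℝ) :=
  {x | ∀ i, (u i : ℝ) * 2 ^ (-(r : ℤ)) ≤ x i ∧ x i < ((u i : ℝ) + 1) * 2 ^ (-(r : ℤ))}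

/-- `u` indexes an `r`-dyadic cube inside `[0,1)^n`. -/
def validIndex (r : ℕ) {n : ℕ} (u : Fin n → ℤ) : Prop := ∀ i, 0 ≤ u i ∧ u i < 2 ^ r

/-- A martingale on `[0,1)^n`, presented as a nonnegative function on dyadic-cube
indices satisfying the fairness (averaging) condition on cubes inside `[0,1)^n`. -/
structure DyadicMartingale (n : ℕ) where
  toFun : ℕ → (Fin n → ℤ) → ℝ
  nonneg : ∀ r u, 0 ≤ toFun r u
  fair : ∀ r u, validIndex r u →
    toFun r u = (2 : ℝ) ^ (-(n : ℤ)) *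
      ∑ a : Fin n → Bool, toFun (r + 1) (fun i => 2 * u i + if a i then 1 else 0)

/-- The index of the unique `r`-dyadic cube containing `x ∈ [0,1)^n`. -/
noncomputable def dyadicIndex (n r : ℕ) (x : Fin n → ℝ) : Fin n → ℤ := fun i => ⌊x i * 2 ^ r⌋

/-- `d` succeeds at `x`: `limsup_r d^{(r)}(x) = ∞`. -/
def succeedsAt {n : ℕ} (d : DyadicMartingale n) (x : Fin n → ℝ) : Prop :=
  Filter.atTop.limsup (fun r => ((d.toFun r (dyadicIndex n r x) : ℝ) : EReal)) = ⊤

/-- The unit cube `[0,1)^n`. -/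
def unitCube (n : ℕ) : Set (Fin n → ℝ) := {x | ∀ i, 0 ≤ x i ∧ x i < 1}

/-- `E^# = [0,1)^n ∩ ⋃_{t ∈ ℤ^n} (E + t)`. -/
def sharp {n : ℕ} (E : Set (Fin n → ℝ)) : Set (Fin n → ℝ) :=
  unitCube n ∩ ⋃ t : Fin n → ℤ, (fun x => x + fun i => (t i : ℝ)) '' E

/-- A martingale is computable if its values can be uniformly computably
approximated to within `2^{-s}` by rationals. -/
def DyadicMartingale.IsComputable {n : ℕ} (d : DyadicMartingale n) : Prop :=
  ∃ dh : ℕ × ℕ × (Fin n → ℤ) → ℚ,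
    Computable dh ∧ (∀ p, 0 ≤ dh p) ∧
    ∀ s r u, validIndex r u →
      |(dh (s, r, u) : ℝ) - d.toFun r u| ≤ 2 ^ (-(s : ℤ))

/-- `E ⊆ ℝ^n` has computable measure 0. -/
def HasComputableMeasureZero {n : ℕ} (E : Set (Fin n → ℝ)) : Prop :=
  ∃ d : DyadicMartingale n, d.IsComputable ∧ ∀ x ∈ sharp E, succeedsAt d x

/-- `x ∈ ℝ^n` is computably random: no computable martingale succeeds at the
unique translate `x + t ∈ [0,1)^n` with `t ∈ ℤ^n`. -/
def ComputablyRandom {n : ℕ} (x : Fin n → ℝ) : Prop :=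
  ∀ d : DyadicMartingale n, d.IsComputable → ¬ succeedsAt d (fun i => Int.fract (x i))

section

open Finset

theorem Primrec.nat_pow : Primrec₂ ((· ^ ·) : ℕ → ℕ → ℕ) :=
  Primrec₂.unpaired'.1 Nat.Primrec.pow

theorem Primrec.sum_range {α : Type*} [Primcodable α] {f : α → ℕ → ℕ} {g : α → ℕ}
    (hf : Primrec₂ f) (hg : Primrec g) : Primrec fun a => ∑ i ∈ range (g a), f a i := by
  have h : Primrec₂ fun (a : α) (p : ℕ × ℕ) => p.2 + f a p.1 :=
    Primrec.nat_add.comp (Primrec.snd.comp Primrec.snd)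
      (hf.comp Primrec.fst (Primrec.fst.comp Primrec.snd))
  refine (Primrec.nat_rec' hg (Primrec.const 0) h).of_eq fun a => ?_
  induction g a with
  | zero => simp
  | succ n ih => simp [Finset.sum_range_succ, ← ih]

theorem Int.encode_natCast (n : ℕ) : Encodable.encode (n : ℤ) = 2 * n := rfl

theorem Int.encode_negSucc (n : ℕ) : Encodable.encode (Int.negSucc n) = 2 * n + 1 := rfl

theorem Primrec.int_toNat : Primrec Int.toNat := by
  have h : Primrec fun n : ℕ => if n % 2 = 0 then n / 2 else 0 :=
    Primrec.ite (Primrec.eq.comp (Primrec.nat_mod.comp Primrec.id (Primrec.const 2))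
      (Primrec.const 0)) (Primrec.nat_div.comp Primrec.id (Primrec.const 2)) (Primrec.const 0)
  refine (h.comp Primrec.encode).of_eq fun z => ?_
  rcases z with n | n
  · simp [Int.encode_natCast]
  · rw [Int.encode_negSucc]
    simp

theorem Int.natAbs_eq_encode (z : ℤ) : z.natAbs = (Encodable.encode z + 1) / 2 := by
  rcases z with n | n
  · simp only [Int.ofNat_eq_natCast, Int.natAbs_natCast, Int.encode_natCast]
    lia
  · rw [Int.encode_negSucc, Int.natAbs_negSucc]
    lia

/-- The codes `Nat.pair (encode num) den` of fractions in lowest terms. -/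
def IsReducedCode (m : ℕ) : Prop :=
  0 < m.unpair.2 ∧ ((m.unpair.1 + 1) / 2).Coprime m.unpair.2

theorem primrecPred_isReducedCode : PrimrecPred IsReducedCode := by
  have hu1 : Primrec fun m : ℕ => m.unpair.1 := Primrec.fst.comp Primrec.unpair
  have hu2 : Primrec fun m : ℕ => m.unpair.2 := Primrec.snd.comp Primrec.unpair
  have hR : PrimrecRel fun k m : ℕ =>
      ((m.unpair.1 + 1) / 2) % k = 0 → m.unpair.2 % k = 0 → k = 1 := by
    have h1 : PrimrecRel fun k m : ℕ => ((m.unpair.1 + 1) / 2) % k = 0 :=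
      Primrec.eq.comp (Primrec.nat_mod.comp
        (Primrec.nat_div.comp (Primrec.succ.comp (hu1.comp Primrec.snd)) (Primrec.const 2))
        Primrec.fst) (Primrec.const 0)
    have h2 : PrimrecRel fun k m : ℕ => m.unpair.2 % k = 0 :=
      Primrec.eq.comp (Primrec.nat_mod.comp (hu2.comp Primrec.snd) Primrec.fst) (Primrec.const 0)
    have h3 : PrimrecRel fun k _ : ℕ => k = 1 := Primrec.eq.comp Primrec.fst (Primrec.const 1)
    exact (PrimrecPred.or (PrimrecPred.not h1) (PrimrecPred.or (PrimrecPred.not h2) h3)).of_eq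
      fun p => by tauto
  have h := PrimrecPred.and (Primrec.nat_lt.comp (Primrec.const 0) hu2)
    (hR.forall_lt.comp (Primrec.succ.comp hu2) Primrec.id)
  refine h.of_eq fun m => and_congr_right fun hpos => ?_
  constructor
  · intro hk
    refine hk _ (Nat.lt_succ_of_le (Nat.le_of_dvd hpos (Nat.gcd_dvd_right _ _))) ?_ ?_
    · exact Nat.mod_eq_zero_of_dvd (Nat.gcd_dvd_left _ _)
    · exact Nat.mod_eq_zero_of_dvd (Nat.gcd_dvd_right _ _)
  · intro hc k _ h1 h2
    exact Nat.eq_one_of_dvd_coprimes hc (Nat.dvd_of_mod_eq_zero h1) (Nat.dvd_of_mod_eq_zero h2)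

theorem Rat.instEncodable_encode (q : ℚ) :
    Rat.instEncodable.encode q = Nat.pair (Encodable.encode q.num) q.den := rfl

theorem Rat.mem_range_instEncodable_encode (m : ℕ) :
    m ∈ Set.range Rat.instEncodable.encode ↔ IsReducedCode m := by
  constructor
  · rintro ⟨q, rfl⟩
    rw [Rat.instEncodable_encode, IsReducedCode, Nat.unpair_pair, ← Int.natAbs_eq_encode]
    exact ⟨q.pos, q.reduced⟩
  · rintro ⟨hpos, hc⟩
    have hz : Encodable.encode (Denumerable.ofNat ℤ m.unpair.1) = m.unpair.1 :=
      Denumerable.encode_ofNat _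
    refine ⟨⟨Denumerable.ofNat ℤ m.unpair.1, m.unpair.2, hpos.ne', ?_⟩, ?_⟩
    · rwa [Int.natAbs_eq_encode, hz]
    · rw [Rat.instEncodable_encode]
      change Nat.pair (Encodable.encode (Denumerable.ofNat ℤ m.unpair.1)) m.unpair.2 = m
      rw [hz, Nat.pair_unpair]

open Classical in
theorem Rat.encode_eq_card (q : ℚ) : Rat.instDenumerable.toEncodable.encode q =
    ∑ m ∈ range (Nat.pair (Encodable.encode q.num) q.den), if IsReducedCode m then 1 else 0 := by
  let := @Encodable.decidableRangeEncode ℚ Rat.instEncodable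
  have h : Rat.instDenumerable.toEncodable.encode q = (List.range (Rat.instEncodable.encode q)).countP
      (fun m => decide (m ∈ Set.range Rat.instEncodable.encode)) := rfl
  rw [h, Rat.instEncodable_encode, ← Finset.card_filter, List.countP_eq_length_filter]
  change _ = (List.filter _ (List.range _)).length
  congr 1
  apply List.filter_congr
  intro m _
  simp [← Rat.mem_range_instEncodable_encode]

theorem Primrec.rat_odd_div_two_pow {α : Type*} [Primcodable α] {A b : α → ℕ}
    (hA : Primrec A) (hb : Primrec b) :
    Primrec fun a => ((2 * A a + 1 : ℕ) : ℚ) / 2 ^ (b a + 1) := by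
  classical
  have hfrac (a : α) : ∃ q : ℚ, ((2 * A a + 1 : ℕ) : ℚ) / 2 ^ (b a + 1) = q ∧
      q.num = (2 * A a + 1 : ℕ) ∧ q.den = 2 ^ (b a + 1) := by
    refine ⟨⟨(2 * A a + 1 : ℕ), 2 ^ (b a + 1), by positivity,
        Nat.Coprime.pow_right _ (by rw [Int.natAbs_natCast]; simp)⟩, ?_, rfl, rfl⟩
    rw [Rat.mk_eq_divInt, Rat.divInt_eq_div]
    push_cast
    rfl
  rw [← Primrec.encode_iff]
  have h : Primrec fun m => if IsReducedCode m then 1 else 0 :=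
    Primrec.ite primrecPred_isReducedCode (Primrec.const 1) (Primrec.const 0)
  have hcode : Primrec fun a => Nat.pair (2 * (2 * A a + 1)) (2 ^ (b a + 1)) :=
    Primrec₂.natPair.comp (Primrec.nat_double.comp (Primrec.nat_double_succ.comp hA))
      (Primrec.nat_pow.comp (Primrec.const 2) (Primrec.succ.comp hb))
  refine (Primrec.sum_range (f := fun _ m => if IsReducedCode m then 1 else 0)
    (h.comp Primrec.snd) hcode).of_eq fun a => ?_
  obtain ⟨q, hq, hnum, hden⟩ := hfrac a
  rw [hq, Rat.encode_eq_card, hnum, hden, Int.encode_natCast]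
/-- The one-dimensional martingale with final capital `1` on the dyadic interval `w` of level `R`,
evaluated at the dyadic interval `v` of level `r`. -/
noncomputable def intervalMartingale (R w r v : ℕ) : ℝ :=
  if v / 2 ^ (r - R) = w / 2 ^ (R - r) then (1 / 2) ^ (R - r) else 0

theorem intervalMartingale_nonneg (R w r v : ℕ) : 0 ≤ intervalMartingale R w r v := by
  unfold intervalMartingale
  split_ifs <;> positivity

theorem intervalMartingale_le (R w r v : ℕ) :
    intervalMartingale R w r v ≤ 2 ^ r * (1 / 2) ^ R := by
  have h : ((1 : ℝ) / 2) ^ (R - r) ≤ 2 ^ r * (1 / 2) ^ R := by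
    rcases le_total R r with h | h
    · rw [Nat.sub_eq_zero_of_le h, pow_zero, one_div, inv_pow, ← div_eq_mul_inv,
        one_le_div (by positivity)]
      exact pow_le_pow_right₀ one_le_two h
    · obtain ⟨c, rfl⟩ := Nat.exists_eq_add_of_le h
      rw [Nat.add_sub_cancel_left, pow_add, ← mul_assoc, ← mul_pow]
      norm_num
  unfold intervalMartingale
  split_ifs
  · exact h
  · positivity

theorem intervalMartingale_fair (R w r v : ℕ) :
    intervalMartingale R w r v =
      (intervalMartingale R w (r + 1) (2 * v) + intervalMartingale R w (r + 1) (2 * v + 1)) / 2 := by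
  unfold intervalMartingale
  rcases le_or_gt R r with h | h
  · have e : r + 1 - R = (r - R) + 1 := by lia
    rw [Nat.sub_eq_zero_of_le h, Nat.sub_eq_zero_of_le (by lia : R ≤ r + 1), e, pow_succ',
      ← Nat.div_div_eq_div_mul, ← Nat.div_div_eq_div_mul, show 2 * v / 2 = v by lia,
      show (2 * v + 1) / 2 = v by lia]
    ring
  · obtain ⟨c, rfl⟩ := Nat.exists_eq_add_of_lt h
    rw [show r + c + 1 - r = c + 1 by lia, show r + c + 1 - (r + 1) = c by lia,
      show r - (r + c + 1) = 0 by lia, show r + 1 - (r + c + 1) = 0 by lia]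
    simp only [pow_zero, Nat.div_one]
    rw [pow_succ 2 c, ← Nat.div_div_eq_div_mul, pow_succ (1 / 2 : ℝ) c]
    generalize w / 2 ^ c = y
    by_cases h1 : v = y / 2
    · rcases Nat.mod_two_eq_zero_or_one y with h2 | h2
      · rw [if_pos h1, if_pos (by lia), if_neg (by lia)]
        ring
      · rw [if_pos h1, if_neg (by lia), if_pos (by lia)]
        ring
    · rw [if_neg h1, if_neg (by lia), if_neg (by lia)]
      simp

theorem intervalMartingale_floor {x : ℝ} {R r : ℕ} (h : R ≤ r) :
    intervalMartingale R ⌊x * 2 ^ R⌋₊ r ⌊x * 2 ^ r⌋₊ = 1 := by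
  unfold intervalMartingale
  obtain ⟨c, rfl⟩ := Nat.exists_eq_add_of_le h
  have e : x * 2 ^ R = x * 2 ^ (R + c) / (2 ^ c : ℕ) := by
    rw [pow_add]
    push_cast
    field_simp
  rw [Nat.sub_eq_zero_of_le h, Nat.add_sub_cancel_left, e, Nat.floor_div_natCast]
  simp

theorem sum_bool_pi_mul {n : ℕ} {i₀ i₁ : Fin n} (hi : i₀ ≠ i₁) (f g : Bool → ℝ) :
    ∑ a : Fin n → Bool, f (a i₀) * g (a i₁) =
      2 ^ n * ((f false + f true) / 2 * ((g false + g true) / 2)) := by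
  set F : Fin n → Bool → ℝ := fun i b => if i = i₀ then f b else if i = i₁ then g b else 1 with hF
  have hprod (a : Fin n → Bool) : f (a i₀) * g (a i₁) = ∏ i, F i (a i) := by
    rw [Fintype.prod_eq_mul i₀ i₁ hi]
    · simp [hF, hi.symm]
    · rintro i ⟨h0, h1⟩
      simp [hF, h0, h1]
  have hsum (i : Fin n) : ∑ b, F i b = 2 * (if i = i₀ then (f false + f true) / 2 else
      if i = i₁ then (g false + g true) / 2 else 1) := by
    simp only [hF, Fintype.sum_bool]
    split_ifs <;> ring
  simp_rw [hprod]
  rw [← Fintype.piFinset_univ, ← Finset.prod_univ_sum]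
  simp_rw [hsum]
  rw [Finset.prod_mul_distrib, Finset.prod_const, Finset.card_univ, Fintype.card_fin,
    Fintype.prod_eq_mul i₀ i₁ hi]
  · simp [hi.symm]
  · rintro i ⟨h0, h1⟩
    simp [h0, h1]

/-- The sum of the square martingales of the squares `(w, G k w p)` of level `R k`, where `w`
ranges over all dyadic intervals of level `R k` and `p < C * 2 ^ (R k - k)`. -/
noncomputable def stageMartingale (R : ℕ → ℕ) (G : ℕ → ℕ → ℕ → ℕ) (C k r v₀ v₁ : ℕ) : ℝ :=
  ∑ w ∈ range (2 ^ R k), ∑ p ∈ range (C * 2 ^ (R k - k)),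
    intervalMartingale (R k) w r v₀ * intervalMartingale (R k) (G k w p) r v₁

section stage

variable {R : ℕ → ℕ} {G : ℕ → ℕ → ℕ → ℕ} {C : ℕ}

theorem stageMartingale_nonneg (k r v₀ v₁ : ℕ) : 0 ≤ stageMartingale R G C k r v₀ v₁ :=
  sum_nonneg fun _ _ => sum_nonneg fun _ _ =>
    mul_nonneg (intervalMartingale_nonneg _ _ _ _) (intervalMartingale_nonneg _ _ _ _)

theorem stageMartingale_le (hR : ∀ k, k ≤ R k) (k r v₀ v₁ : ℕ) :
    stageMartingale R G C k r v₀ v₁ ≤ C * 4 ^ r * (1 / 2) ^ k := by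
  calc stageMartingale R G C k r v₀ v₁
      ≤ ∑ w ∈ range (2 ^ R k), ∑ p ∈ range (C * 2 ^ (R k - k)),
          (2 ^ r * (1 / 2) ^ R k : ℝ) * (2 ^ r * (1 / 2) ^ R k) :=
        sum_le_sum fun w _ => sum_le_sum fun p _ =>
          mul_le_mul (intervalMartingale_le _ _ _ _) (intervalMartingale_le _ _ _ _)
            (intervalMartingale_nonneg _ _ _ _) (by positivity)
    _ = C * 4 ^ r * (1 / 2) ^ k := by
        obtain ⟨c, hc⟩ := Nat.exists_eq_add_of_le (hR k)
        rw [hc, Nat.add_sub_cancel_left]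
        simp only [sum_const, card_range, nsmul_eq_mul]
        push_cast
        rw [show (4 : ℝ) = 2 * 2 by norm_num, mul_pow, one_div, inv_pow, inv_pow, pow_add]
        field_simp

theorem summable_stageMartingale (hR : ∀ k, k ≤ R k) (r v₀ v₁ : ℕ) :
    Summable fun k => stageMartingale R G C k r v₀ v₁ :=
  Summable.of_nonneg_of_le (fun k => stageMartingale_nonneg k r v₀ v₁)
    (fun k => stageMartingale_le hR k r v₀ v₁) (summable_geometric_two.mul_left _)

theorem stageMartingale_fair {n : ℕ} {i₀ i₁ : Fin n} (hi : i₀ ≠ i₁) (k r : ℕ) (v : Fin n → ℕ) :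
    stageMartingale R G C k r (v i₀) (v i₁) = (2 : ℝ) ^ (-(n : ℤ)) * ∑ a : Fin n → Bool,
      stageMartingale R G C k (r + 1) (2 * v i₀ + if a i₀ then 1 else 0)
        (2 * v i₁ + if a i₁ then 1 else 0) := by
  unfold stageMartingale
  rw [sum_comm (s := (univ : Finset (Fin n → Bool))), mul_sum]
  refine sum_congr rfl fun w _ => ?_
  rw [sum_comm (s := (univ : Finset (Fin n → Bool))), mul_sum]
  refine sum_congr rfl fun p _ => ?_
  rw [sum_bool_pi_mul hi (fun b => intervalMartingale (R k) w (r + 1)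
      (2 * v i₀ + if b then 1 else 0)) (fun b => intervalMartingale (R k) (G k w p) (r + 1)
      (2 * v i₁ + if b then 1 else 0)), intervalMartingale_fair, intervalMartingale_fair _ _ _ (v i₁),
    zpow_neg, zpow_natCast, inv_mul_cancel_left₀ (by positivity)]
  simp

/-- The martingale on `[0,1)^n` obtained by summing all stages in the coordinates `i₀, i₁`. -/
noncomputable def sumMartingale (G : ℕ → ℕ → ℕ → ℕ) (C : ℕ) (hR : ∀ k, k ≤ R k) {n : ℕ}
    {i₀ i₁ : Fin n} (hi : i₀ ≠ i₁) : DyadicMartingale n where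
  toFun r u := ∑' k, stageMartingale R G C k r (u i₀).toNat (u i₁).toNat
  nonneg r u := tsum_nonneg fun k => stageMartingale_nonneg k _ _ _
  fair r u hu := by
    have hbit (i : Fin n) (b : Bool) : (2 * u i + if b then 1 else 0).toNat =
        2 * (u i).toNat + if b then 1 else 0 := by
      have := (hu i).1
      cases b <;> simp <;> lia
    simp_rw [hbit]
    rw [← Summable.tsum_finsetSum fun a _ => summable_stageMartingale hR _ _ _, ← tsum_mul_left]
    exact tsum_congr fun k => stageMartingale_fair hi k r fun i => (u i).toNat

theorem succeedsAt_sumMartingale (hR : ∀ k, k ≤ R k) {n : ℕ} {i₀ i₁ : Fin n} (hi : i₀ ≠ i₁)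
    {x : Fin n → ℝ} (hx₀ : 0 ≤ x i₀) (hx₁ : x i₀ < 1)
    (hx : ∀ k, ∃ p < C * 2 ^ (R k - k), ⌊x i₁ * 2 ^ R k⌋₊ = G k ⌊x i₀ * 2 ^ R k⌋₊ p) :
    succeedsAt (sumMartingale G C hR hi) x := by
  refine Tendsto.limsup_eq (EReal.tendsto_coe_nhds_top_iff.2 (tendsto_atTop.2 fun b => ?_))
  obtain ⟨K, hK⟩ := exists_nat_ge b
  filter_upwards [eventually_ge_atTop (∑ k ∈ range K, R k)] with r hr
  have hone (k : ℕ) (hk : k ∈ range K) : 1 ≤ stageMartingale R G C k r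
      (dyadicIndex n r x i₀).toNat (dyadicIndex n r x i₁).toNat := by
    have hkr : R k ≤ r := (single_le_sum (f := R) (fun _ _ => Nat.zero_le _) hk).trans hr
    obtain ⟨p, hp, hG⟩ := hx k
    have hw : ⌊x i₀ * 2 ^ R k⌋₊ ∈ range (2 ^ R k) := by
      rw [mem_range, Nat.floor_lt (by positivity)]
      push_cast
      exact mul_lt_of_lt_one_left (by positivity) hx₁
    have hterm : intervalMartingale (R k) ⌊x i₀ * 2 ^ R k⌋₊ r (dyadicIndex n r x i₀).toNat *
        intervalMartingale (R k) (G k ⌊x i₀ * 2 ^ R k⌋₊ p) r (dyadicIndex n r x i₁).toNat = 1 := by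
      rw [← hG]
      simp only [dyadicIndex, Int.floor_toNat]
      rw [intervalMartingale_floor hkr, intervalMartingale_floor hkr, one_mul]
    rw [← hterm]
    have hnn (w p : ℕ) : 0 ≤ intervalMartingale (R k) w r (dyadicIndex n r x i₀).toNat *
        intervalMartingale (R k) (G k w p) r (dyadicIndex n r x i₁).toNat :=
      mul_nonneg (intervalMartingale_nonneg _ _ _ _) (intervalMartingale_nonneg _ _ _ _)
    refine (single_le_sum (f := fun p => _ * intervalMartingale (R k) (G k _ p) r _)
      (fun p _ => hnn ⌊x i₀ * 2 ^ R k⌋₊ p) (mem_range.2 hp)).trans ?_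
    exact single_le_sum (f := fun w => ∑ p ∈ range (C * 2 ^ (R k - k)),
      intervalMartingale (R k) w r _ * intervalMartingale (R k) (G k w p) r _)
      (fun w _ => sum_nonneg fun p _ => hnn w p) hw
  calc b ≤ ∑ k ∈ range K, (1 : ℝ) := by simpa using hK
    _ ≤ _ := sum_le_sum hone
    _ ≤ _ := (summable_stageMartingale hR _ _ _).sum_le_tsum _
        fun k _ => stageMartingale_nonneg _ _ _ _

/-- The integer `2 ^ D * intervalMartingale R w r v`, for `R ≤ D`. -/
def scaledIntervalMartingale (D R w r v : ℕ) : ℕ :=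
  if v / 2 ^ (r - R) = w / 2 ^ (R - r) then 2 ^ (D - (R - r)) else 0

theorem cast_scaledIntervalMartingale {D R : ℕ} (h : R ≤ D) (w r v : ℕ) :
    (scaledIntervalMartingale D R w r v : ℝ) = 2 ^ D * intervalMartingale R w r v := by
  unfold scaledIntervalMartingale intervalMartingale
  split_ifs
  · obtain ⟨c, hc⟩ := Nat.exists_eq_add_of_le (show R - r ≤ D by lia)
    rw [hc, Nat.add_sub_cancel_left, one_div, inv_pow, pow_add]
    push_cast
    field_simp
  · simp

theorem Primrec.scaledIntervalMartingale {α : Type*} [Primcodable α] {D R w r v : α → ℕ}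
    (hD : Primrec D) (hR : Primrec R) (hw : Primrec w) (hr : Primrec r) (hv : Primrec v) :
    Primrec fun a => scaledIntervalMartingale (D a) (R a) (w a) (r a) (v a) := by
  have two_pow {f : α → ℕ} (hf : Primrec f) : Primrec fun a => 2 ^ f a :=
    Primrec.nat_pow.comp (Primrec.const 2) hf
  exact Primrec.ite
    (Primrec.eq.comp (Primrec.nat_div.comp hv (two_pow (Primrec.nat_sub.comp hr hR)))
      (Primrec.nat_div.comp hw (two_pow (Primrec.nat_sub.comp hR hr))))
    (two_pow (Primrec.nat_sub.comp hD (Primrec.nat_sub.comp hR hr))) (Primrec.const 0)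

/-- The integer `4 ^ D` times the sum of the first `N` stages, for `D` large enough. -/
def scaledPartialSum (R : ℕ → ℕ) (G : ℕ → ℕ → ℕ → ℕ) (C D N r v₀ v₁ : ℕ) : ℕ :=
  ∑ k ∈ range N, ∑ w ∈ range (2 ^ R k), ∑ p ∈ range (C * 2 ^ (R k - k)),
    scaledIntervalMartingale D (R k) w r v₀ * scaledIntervalMartingale D (R k) (G k w p) r v₁

theorem cast_scaledPartialSum {D N : ℕ} (h : ∀ k < N, R k ≤ D) (r v₀ v₁ : ℕ) :
    (scaledPartialSum R G C D N r v₀ v₁ : ℝ) =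
      2 ^ (2 * D) * ∑ k ∈ range N, stageMartingale R G C k r v₀ v₁ := by
  simp only [scaledPartialSum, stageMartingale, Nat.cast_sum, Nat.cast_mul, mul_sum]
  refine sum_congr rfl fun k hk => sum_congr rfl fun w _ => sum_congr rfl fun p _ => ?_
  have hk := h k (mem_range.1 hk)
  rw [cast_scaledIntervalMartingale hk, cast_scaledIntervalMartingale hk, two_mul, pow_add]
  ring

theorem Primrec.scaledPartialSum {α : Type*} [Primcodable α] {D N r v₀ v₁ : α → ℕ}
    (hR : Primrec R) (hG : Primrec fun q : ℕ × ℕ × ℕ => G q.1 q.2.1 q.2.2)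
    (hD : Primrec D) (hN : Primrec N) (hr : Primrec r) (hv₀ : Primrec v₀) (hv₁ : Primrec v₁) :
    Primrec fun a => scaledPartialSum R G C (D a) (N a) (r a) (v₀ a) (v₁ a) := by
  have two_pow {β : Type _} [Primcodable β] {f : β → ℕ} (hf : Primrec f) :
      Primrec fun a => 2 ^ f a := Primrec.nat_pow.comp (Primrec.const 2) hf
  refine Primrec.sum_range (Primrec.sum_range (Primrec.sum_range ?_ ?_) ?_) hN
  · have ha : Primrec fun q : ((α × ℕ) × ℕ) × ℕ => q.1.1.1 :=
      Primrec.fst.comp (Primrec.fst.comp Primrec.fst)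
    have hk : Primrec fun q : ((α × ℕ) × ℕ) × ℕ => q.1.1.2 :=
      Primrec.snd.comp (Primrec.fst.comp Primrec.fst)
    have hw : Primrec fun q : ((α × ℕ) × ℕ) × ℕ => q.1.2 := Primrec.snd.comp Primrec.fst
    exact Primrec.nat_mul.comp
      (Primrec.scaledIntervalMartingale (hD.comp ha) (hR.comp hk) hw (hr.comp ha) (hv₀.comp ha))
      (Primrec.scaledIntervalMartingale (hD.comp ha) (hR.comp hk)
        (hG.comp (hk.pair (hw.pair Primrec.snd))) (hr.comp ha) (hv₁.comp ha))
  · have hk : Primrec fun q : (α × ℕ) × ℕ => q.1.2 := Primrec.snd.comp Primrec.fst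
    exact Primrec.nat_mul.comp (Primrec.const C)
      (two_pow (Primrec.nat_sub.comp (hR.comp hk) hk))
  · exact two_pow (hR.comp Primrec.snd)

theorem abs_sum_stageMartingale_sub_tsum_le (hR : ∀ k, k ≤ R k) (s r v₀ v₁ : ℕ) :
    |∑ k ∈ range (s + 2 * r + C + 2), stageMartingale R G C k r v₀ v₁ -
      ∑' k, stageMartingale R G C k r v₀ v₁| ≤ (1 / 2) ^ (s + 1) := by
  obtain ⟨N, hN⟩ : ∃ N, N = s + 2 * r + C + 2 := ⟨_, rfl⟩
  rw [← hN]
  have hsum := summable_stageMartingale (G := G) (C := C) hR r v₀ v₁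
  have hgeom := summable_geometric_two.mul_left ((C : ℝ) * 4 ^ r * (1 / 2) ^ N)
  have hle (k : ℕ) : stageMartingale R G C (k + N) r v₀ v₁ ≤
      C * 4 ^ r * (1 / 2) ^ N * (1 / 2) ^ k := by
    refine (stageMartingale_le hR (k + N) r v₀ v₁).trans_eq ?_
    rw [add_comm k N, pow_add, mul_assoc, mul_assoc, mul_assoc]
  rw [← hsum.sum_add_tsum_nat_add N, sub_add_cancel_left, abs_neg,
    abs_of_nonneg (tsum_nonneg fun k => stageMartingale_nonneg _ _ _ _)]
  calc ∑' k, stageMartingale R G C (k + N) r v₀ v₁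
      ≤ ∑' k : ℕ, (C : ℝ) * 4 ^ r * (1 / 2) ^ N * (1 / 2) ^ k :=
        Summable.tsum_le_tsum hle
          (hsum.comp_injective (add_left_injective N)) hgeom
    _ = C * 4 ^ r * (1 / 2) ^ N * 2 := by rw [tsum_mul_left, tsum_geometric_two]
    _ = (4 ^ r * (1 / 4) ^ r) * (C * (1 / 2) ^ C) * (1 / 2) ^ (s + 1) := by
        rw [hN, pow_add, pow_add, pow_add, pow_mul]
        norm_num
        ring
    _ = (C * (1 / 2) ^ C) * (1 / 2) ^ (s + 1) := by
        rw [← mul_pow]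
        norm_num
    _ ≤ 1 * (1 / 2) ^ (s + 1) := by
        gcongr
        rw [one_div, inv_pow, ← div_eq_mul_inv, div_le_one (by positivity)]
        exact_mod_cast Nat.lt_two_pow_self.le
    _ = _ := one_mul _

theorem isComputable_sumMartingale (hk : ∀ k, k ≤ R k) (hR : Primrec R)
    (hG : Primrec fun q : ℕ × ℕ × ℕ => G q.1 q.2.1 q.2.2) {n : ℕ} {i₀ i₁ : Fin n} (hi : i₀ ≠ i₁) :
    (sumMartingale G C hk hi).IsComputable := by
  let N (q : ℕ × ℕ × (Fin n → ℤ)) : ℕ := q.1 + 2 * q.2.1 + C + 2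
  let D (q : ℕ × ℕ × (Fin n → ℤ)) : ℕ := q.1 + ∑ k ∈ range (N q), R k
  let A (q : ℕ × ℕ × (Fin n → ℤ)) : ℕ :=
    scaledPartialSum R G C (D q) (N q) q.2.1 (q.2.2 i₀).toNat (q.2.2 i₁).toNat
  have hr : Primrec fun q : ℕ × ℕ × (Fin n → ℤ) => q.2.1 := Primrec.fst.comp Primrec.snd
  have hv (i : Fin n) : Primrec fun q : ℕ × ℕ × (Fin n → ℤ) => (q.2.2 i).toNat :=
    Primrec.int_toNat.comp (Primrec.fin_app.comp (Primrec.snd.comp Primrec.snd) (Primrec.const i))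
  have hN : Primrec N := Primrec.nat_add.comp (Primrec.nat_add.comp (Primrec.nat_add.comp
    Primrec.fst (Primrec.nat_double.comp hr)) (Primrec.const C)) (Primrec.const 2)
  have hD : Primrec D := Primrec.nat_add.comp Primrec.fst
    (Primrec.sum_range (f := fun _ k => R k) (hR.comp Primrec.snd) hN)
  have hA : Primrec A := Primrec.scaledPartialSum hR hG hD hN hr (hv i₀) (hv i₁)
  refine ⟨fun q => ((2 * A q + 1 : ℕ) : ℚ) / 2 ^ (2 * D q + 1),
    (Primrec.rat_odd_div_two_pow hA (Primrec.nat_double.comp hD)).to_comp,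
    fun q => by positivity, fun s r u _ => ?_⟩
  have hDk (k : ℕ) (hk : k < N (s, r, u)) : R k ≤ D (s, r, u) :=
    (single_le_sum (f := R) (fun _ _ => Nat.zero_le _) (mem_range.2 hk)).trans (Nat.le_add_left _ _)
  have hval : ((((2 * A (s, r, u) + 1 : ℕ) : ℚ) / 2 ^ (2 * D (s, r, u) + 1) : ℚ) : ℝ) =
      ∑ k ∈ range (N (s, r, u)), stageMartingale R G C k r (u i₀).toNat (u i₁).toNat +
        (1 / 2) ^ (2 * D (s, r, u) + 1) := by
    push_cast
    rw [cast_scaledPartialSum hDk, one_div, inv_pow, pow_succ]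
    field_simp
  have hD' : ((1 : ℝ) / 2) ^ (2 * D (s, r, u) + 1) ≤ (1 / 2) ^ (s + 1) :=
    pow_le_pow_of_le_one (by norm_num) (by norm_num) (by simp only [D]; lia)
  have htail := abs_sum_stageMartingale_sub_tsum_le (G := G) (C := C) hk s r
    (u i₀).toNat (u i₁).toNat
  rw [hval, add_sub_right_comm]
  refine (abs_add_le _ _).trans ((add_le_add htail
    ((abs_of_nonneg (by positivity)).trans_le hD')).trans_eq ?_)
  rw [zpow_neg, zpow_natCast, one_div, inv_pow, pow_succ]
  field_simp
  norm_num

/-- A point whose coordinates `i₀, i₁` lie, for every `k`, in one of the uniformly computable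
squares `(w, G k w p)` of level `R k` is not computably random. -/
theorem not_computablyRandom_of_forall_exists (hk : ∀ k, k ≤ R k) (hR : Primrec R)
    (hG : Primrec fun q : ℕ × ℕ × ℕ => G q.1 q.2.1 q.2.2) {n : ℕ} {i₀ i₁ : Fin n} (hi : i₀ ≠ i₁)
    {x : Fin n → ℝ} (hx : ∀ k, ∃ p < C * 2 ^ (R k - k),
      ⌊Int.fract (x i₁) * 2 ^ R k⌋₊ = G k ⌊Int.fract (x i₀) * 2 ^ R k⌋₊ p) :
    ¬ ComputablyRandom x := fun h =>
  h (sumMartingale G C hk hi) (isComputable_sumMartingale hk hR hG hi)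
    (succeedsAt_sumMartingale hk hi (Int.fract_nonneg _) (Int.fract_lt_one _) hx)

end stage

/-- The `i`-th digit of `m` in the mixed-radix expansion whose `i`-th place value is
`2 ^ (-(i + 1) ^ 2)`. -/
noncomputable def squareDigit (m : ℝ) (i : ℕ) : ℕ := ⌊m * 2 ^ (i + 1) ^ 2⌋₊ % 2 ^ (2 * i + 1)

/-- The contribution of the `i`-th digit of `m` to the value of `m`. -/
noncomputable def squareDigitValue (m : ℝ) (i : ℕ) : ℝ := squareDigit m i / 2 ^ (i + 1) ^ 2

theorem floor_mul_two_pow_div (m : ℝ) {a b : ℕ} (h : a ≤ b) :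
    ⌊m * 2 ^ b⌋₊ / 2 ^ (b - a) = ⌊m * 2 ^ a⌋₊ := by
  obtain ⟨c, rfl⟩ := Nat.exists_eq_add_of_le h
  have e : m * 2 ^ a = m * 2 ^ (a + c) / (2 ^ c : ℕ) := by
    rw [pow_add]
    push_cast
    field_simp
  rw [Nat.add_sub_cancel_left, e, Nat.floor_div_natCast]

theorem squareDigitValue_nonneg (m : ℝ) (i : ℕ) : 0 ≤ squareDigitValue m i := by
  unfold squareDigitValue
  positivity

theorem squareDigitValue_le (m : ℝ) (i : ℕ) : squareDigitValue m i ≤ (1 / 2) ^ i ^ 2 := by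
  have h : (squareDigit m i : ℝ) ≤ 2 ^ (2 * i + 1) := by
    exact_mod_cast (Nat.mod_lt _ (by positivity)).le
  rw [squareDigitValue, div_le_iff₀ (by positivity), show (i + 1) ^ 2 = i ^ 2 + (2 * i + 1) by ring,
    pow_add, ← mul_assoc, ← mul_pow]
  simpa using h

theorem sum_squareDigitValue {m : ℝ} (hm : m < 1) (j : ℕ) :
    ∑ i ∈ range j, squareDigitValue m i = ⌊m * 2 ^ j ^ 2⌋₊ / 2 ^ j ^ 2 := by
  induction j with
  | zero => simp [Nat.floor_eq_zero.2 hm]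
  | succ j ih =>
    have hsq : (j + 1) ^ 2 = j ^ 2 + (2 * j + 1) := by ring
    have h := floor_mul_two_pow_div m (show j ^ 2 ≤ (j + 1) ^ 2 by lia)
    rw [show (j + 1) ^ 2 - j ^ 2 = 2 * j + 1 by lia] at h
    have hdm := Nat.div_add_mod ⌊m * 2 ^ (j + 1) ^ 2⌋₊ (2 ^ (2 * j + 1))
    rw [sum_range_succ, ih, squareDigitValue, squareDigit]
    nth_rewrite 2 [← hdm]
    rw [h, hsq, pow_add]
    push_cast
    field_simp

theorem hasSum_squareDigitValue {m : ℝ} (h₀ : 0 ≤ m) (h₁ : m < 1) :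
    HasSum (squareDigitValue m) m := by
  rw [hasSum_iff_tendsto_nat_of_nonneg (squareDigitValue_nonneg m)]
  have hlim : Tendsto (fun j : ℕ => m - (1 / 2 : ℝ) ^ j) atTop (nhds m) := by
    simpa using tendsto_const_nhds.sub
      (tendsto_pow_atTop_nhds_zero_of_lt_one (r := (1 / 2 : ℝ)) (by norm_num) (by norm_num))
  refine tendsto_of_tendsto_of_tendsto_of_le_of_le hlim tendsto_const_nhds (fun j => ?_) fun j => ?_
  · rw [sum_squareDigitValue h₁, le_div_iff₀ (by positivity), sub_mul]
    have h := (Nat.lt_floor_add_one (m * 2 ^ j ^ 2)).le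
    have h2 : (1 : ℝ) ≤ (1 / 2) ^ j * 2 ^ j ^ 2 := by
      rw [one_div, inv_pow, ← div_eq_inv_mul, one_le_div (by positivity)]
      exact pow_le_pow_right₀ one_le_two (Nat.le_self_pow two_ne_zero j)
    linarith
  · rw [sum_squareDigitValue h₁, div_le_iff₀ (by positivity)]
    exact Nat.floor_le (by positivity)

section intercept

variable {c : ℕ → ℝ}

theorem abs_mul_squareDigitValue_le (hc : ∀ i, |c i| ≤ 2 * i) (x m : ℝ) (i : ℕ) :
    |(x - c i) * squareDigitValue m i| ≤ (|x| + 2) * (2 ^ i * (1 / 2) ^ i ^ 2) := by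
  have hi : (i : ℝ) ≤ 2 ^ i := by exact_mod_cast Nat.lt_two_pow_self.le
  have h1 : (1 : ℝ) ≤ 2 ^ i := one_le_pow₀ one_le_two
  have h : |x - c i| ≤ (|x| + 2) * 2 ^ i := by
    nlinarith [abs_sub x (c i), hc i, abs_nonneg x]
  rw [abs_mul, abs_of_nonneg (squareDigitValue_nonneg m i), ← mul_assoc]
  exact mul_le_mul h (squareDigitValue_le m i) (squareDigitValue_nonneg m i) (by positivity)

theorem two_pow_mul_half_pow_sq (j n : ℕ) :
    (2 : ℝ) ^ (n + (j + 1)) * (1 / 2) ^ (n + (j + 1)) ^ 2 ≤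
      (1 / 2) ^ j ^ 2 * (1 / 2) ^ j * (1 / 2) ^ n := by
  have h : (n + (j + 1)) ^ 2 = (n + (j + 1)) + (j ^ 2 + j + n + (n ^ 2 + 2 * n * j)) := by ring
  rw [h, pow_add (1 / 2 : ℝ), ← mul_assoc, ← mul_pow, ← pow_add, ← pow_add]
  norm_num1
  rw [one_pow, one_mul]
  exact pow_le_pow_of_le_one (by norm_num) (by norm_num) (Nat.le_add_right _ _)

theorem summable_mul_squareDigitValue (hc : ∀ i, |c i| ≤ 2 * i) (x m : ℝ) :
    Summable fun i => (x - c i) * squareDigitValue m i := by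
  rw [← summable_nat_add_iff 1]
  refine Summable.of_norm_bounded (summable_geometric_two.mul_left (|x| + 2)) fun n => ?_
  refine (abs_mul_squareDigitValue_le hc x m (n + 1)).trans ?_
  gcongr
  simpa using two_pow_mul_half_pow_sq 0 n

/-- The intercept assigned to the slope `m` by the sequence `c`. -/
noncomputable def digitIntercept (c : ℕ → ℝ) (m : ℝ) : ℝ := -∑' i, c i * squareDigitValue m i

theorem hasSum_line (hc : ∀ i, |c i| ≤ 2 * i) {m : ℝ} (h₀ : 0 ≤ m) (h₁ : m < 1) (x : ℝ) :
    HasSum (fun i => (x - c i) * squareDigitValue m i) (m * x + digitIntercept c m) := by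
  have hx := (hasSum_squareDigitValue h₀ h₁).mul_left x
  have hcs := (summable_mul_squareDigitValue hc 0 m).hasSum
  have h := hx.add hcs
  simp only [zero_sub, neg_mul, tsum_neg] at h
  rw [digitIntercept, mul_comm]
  refine h.congr_fun ?_
  exact fun i => by ring

theorem abs_line_sub_sum_le (hc : ∀ i, |c i| ≤ 2 * i) {m : ℝ} (h₀ : 0 ≤ m) (h₁ : m < 1) {x : ℝ}
    {k j : ℕ} (hkj : k ≤ j) (hx : |x - c j| ≤ (1 / 2) ^ k) :
    |m * x + digitIntercept c m - ∑ i ∈ range j, (x - c i) * squareDigitValue m i| ≤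
      (2 * |x| + 5) * ((1 / 2) ^ k * (1 / 2) ^ j ^ 2) := by
  have hs := summable_mul_squareDigitValue hc x m
  have htail : |∑' n, (x - c (n + (j + 1))) * squareDigitValue m (n + (j + 1))| ≤
      (|x| + 2) * ((1 / 2) ^ j ^ 2 * (1 / 2) ^ j) * 2 := by
    rw [← Real.norm_eq_abs]
    refine tsum_of_norm_bounded
      (f := fun n => (x - c (n + (j + 1))) * squareDigitValue m (n + (j + 1)))
      (hasSum_geometric_two.mul_left ((|x| + 2) * ((1 / 2) ^ j ^ 2 * (1 / 2) ^ j))) fun n => ?_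
    refine (abs_mul_squareDigitValue_le hc x m _).trans ?_
    rw [mul_assoc (|x| + 2)]
    exact mul_le_mul_of_nonneg_left (two_pow_mul_half_pow_sq j n) (by positivity)
  have hj : |(x - c j) * squareDigitValue m j| ≤ (1 / 2) ^ k * (1 / 2) ^ j ^ 2 := by
    rw [abs_mul, abs_of_nonneg (squareDigitValue_nonneg m j)]
    exact mul_le_mul hx (squareDigitValue_le m j) (squareDigitValue_nonneg m j) (by positivity)
  have hpow : ((1 : ℝ) / 2) ^ j ≤ (1 / 2) ^ k :=
    pow_le_pow_of_le_one (by norm_num) (by norm_num) hkj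
  rw [← (hasSum_line hc h₀ h₁ x).tsum_eq, ← hs.sum_add_tsum_nat_add (j + 1), sum_range_succ,
    add_assoc, add_sub_cancel_left]
  calc _ ≤ _ := abs_add_le _ _
    _ ≤ _ := add_le_add hj htail
    _ ≤ (1 / 2) ^ k * (1 / 2) ^ j ^ 2 + (|x| + 2) * ((1 / 2) ^ j ^ 2 * (1 / 2) ^ k) * 2 := by gcongr
    _ = _ := by ring

end intercept


/-- A code for the dyadic rational `a - b + i / 2 ^ k`. -/
def dyadicCode (a b k i : ℕ) : ℕ := Nat.pair (Nat.pair a b) (Nat.pair k i)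

/-- For `j = dyadicCode a b k i`, the number `2 ^ j * (a + i / 2 ^ k)`. -/
def posNumerator (j : ℕ) : ℕ :=
  (j.unpair.1.unpair.1 * 2 ^ j.unpair.2.unpair.1 + j.unpair.2.unpair.2) *
    2 ^ (j - j.unpair.2.unpair.1)

/-- For `j = dyadicCode a b k i`, the number `2 ^ j * b`. -/
def negNumerator (j : ℕ) : ℕ := j.unpair.1.unpair.2 * 2 ^ j

/-- The dyadic rational with code `j`. -/
noncomputable def dyadicOfCode (j : ℕ) : ℝ := posNumerator j / 2 ^ j - negNumerator j / 2 ^ j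

theorem dyadicCode_unpair (j : ℕ) : dyadicCode j.unpair.1.unpair.1 j.unpair.1.unpair.2
    j.unpair.2.unpair.1 j.unpair.2.unpair.2 = j := by
  simp [dyadicCode]

theorem add_add_le_dyadicCode (a b k i : ℕ) : a + b + (k + i) ≤ dyadicCode a b k i :=
  (add_le_add (Nat.add_le_pair a b) (Nat.add_le_pair k i)).trans (Nat.add_le_pair _ _)

theorem dyadicOfCode_dyadicCode (a b k i : ℕ) :
    dyadicOfCode (dyadicCode a b k i) = a - b + i / 2 ^ k := by
  have hk : k ≤ dyadicCode a b k i := by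
    have := add_add_le_dyadicCode a b k i
    lia
  have hpow : (2 : ℝ) ^ dyadicCode a b k i = 2 ^ (dyadicCode a b k i - k) * 2 ^ k := by
    rw [← pow_add, Nat.sub_add_cancel hk]
  have h₁ : posNumerator (dyadicCode a b k i) =
      (a * 2 ^ k + i) * 2 ^ (dyadicCode a b k i - k) := by
    simp [posNumerator, dyadicCode]
  have h₂ : negNumerator (dyadicCode a b k i) = b * 2 ^ dyadicCode a b k i := by
    simp [negNumerator, dyadicCode]
  rw [dyadicOfCode, h₁, h₂]
  push_cast
  rw [hpow]
  field_simp
  ring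

theorem abs_dyadicOfCode_le (j : ℕ) : |dyadicOfCode j| ≤ 2 * j := by
  have hle := add_add_le_dyadicCode j.unpair.1.unpair.1 j.unpair.1.unpair.2
    j.unpair.2.unpair.1 j.unpair.2.unpair.2
  rw [dyadicCode_unpair] at hle
  rw [← dyadicCode_unpair j, dyadicOfCode_dyadicCode, dyadicCode_unpair]
  set a := j.unpair.1.unpair.1
  set b := j.unpair.1.unpair.2
  set k := j.unpair.2.unpair.1
  set i := j.unpair.2.unpair.2
  have hcast : (a : ℝ) + b + (k + i) ≤ j := by exact_mod_cast hle
  have hi : (i : ℝ) / 2 ^ k ≤ i := div_le_self (by positivity) (one_le_pow₀ one_le_two)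
  have hi₀ : (0 : ℝ) ≤ i / 2 ^ k := by positivity
  have ha : (0 : ℝ) ≤ a := by positivity
  have hb : (0 : ℝ) ≤ b := by positivity
  have hk : (0 : ℝ) ≤ k := by positivity
  rw [abs_le]
  constructor <;> linarith

/-- The number of binary digits used at stage `k` for points with integer part `a - b`. -/
def stagePrecision (a b k : ℕ) : ℕ := (dyadicCode a b k (2 ^ k) + 1) ^ 2

theorem dyadicCode_mono {a b k i i' : ℕ} (h : i ≤ i') :
    dyadicCode a b k i ≤ dyadicCode a b k i' := by
  have hpair (c : ℕ) : Monotone (Nat.pair c) :=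
    (strictMono_nat_of_lt_succ fun n => Nat.pair_lt_pair_right c n.lt_succ_self).monotone
  exact hpair _ (hpair _ h)

theorem sq_add_self_le_stagePrecision {a b k i : ℕ} (h : i ≤ 2 ^ k) :
    dyadicCode a b k i ^ 2 + dyadicCode a b k i ≤ stagePrecision a b k := by
  rw [stagePrecision]
  nlinarith [dyadicCode_mono (a := a) (b := b) (k := k) h]

theorem le_dyadicCode (a b k i : ℕ) : k ≤ dyadicCode a b k i := by
  have := add_add_le_dyadicCode a b k i
  lia

theorem le_stagePrecision (a b k : ℕ) : k ≤ stagePrecision a b k := by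
  have h₁ := le_dyadicCode a b k (2 ^ k)
  have h₂ := sq_add_self_le_stagePrecision (a := a) (b := b) (le_refl (2 ^ k))
  lia

/-- For `P = ⌊m * 2 ^ j ^ 2⌋₊`, the number `2 ^ R * ∑ i < j, f i / 2 ^ i * squareDigitValue m i`. -/
def weightedDigitSum (f : ℕ → ℕ) (R j P : ℕ) : ℕ :=
  ∑ i ∈ range j, f i * (P / 2 ^ (j ^ 2 - (i + 1) ^ 2) % 2 ^ (2 * i + 1)) *
    2 ^ (R - (i + (i + 1) ^ 2))

theorem cast_weightedDigitSum (f : ℕ → ℕ) {R j : ℕ} (h : j ^ 2 + j ≤ R) (m : ℝ) :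
    (weightedDigitSum f R j ⌊m * 2 ^ j ^ 2⌋₊ : ℝ) =
      2 ^ R * ∑ i ∈ range j, f i / 2 ^ i * squareDigitValue m i := by
  rw [weightedDigitSum, Nat.cast_sum, mul_sum]
  refine sum_congr rfl fun i hi => ?_
  have hij : i + 1 ≤ j := mem_range.1 hi
  have hsq : (i + 1) ^ 2 ≤ j ^ 2 := Nat.pow_le_pow_left hij 2
  have hpow : (2 : ℝ) ^ R = 2 ^ (R - (i + (i + 1) ^ 2)) * (2 ^ i * 2 ^ (i + 1) ^ 2) := by
    rw [← pow_add, ← pow_add, Nat.sub_add_cancel (by lia)]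
  rw [floor_mul_two_pow_div m hsq, squareDigitValue, squareDigit, hpow, Nat.cast_mul, Nat.cast_mul]
  push_cast
  field_simp

theorem sum_sub_dyadicOfCode_mul {R j : ℕ} (h : j ^ 2 + j ≤ R) {m : ℝ} (hm : m < 1) (x : ℝ) :
    2 ^ R * ∑ i ∈ range j, (x - dyadicOfCode i) * squareDigitValue m i =
      2 ^ R * x * (⌊m * 2 ^ j ^ 2⌋₊ / 2 ^ j ^ 2) -
        weightedDigitSum posNumerator R j ⌊m * 2 ^ j ^ 2⌋₊ +
        weightedDigitSum negNumerator R j ⌊m * 2 ^ j ^ 2⌋₊ := by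
  rw [cast_weightedDigitSum _ h, cast_weightedDigitSum _ h, ← sum_squareDigitValue hm]
  simp only [dyadicOfCode, sub_mul, sum_sub_distrib, ← mul_sum]
  ring

theorem natCast_floor_fract_mul (y : ℝ) (R : ℕ) :
    (⌊Int.fract y * 2 ^ R⌋₊ : ℤ) = ⌊y * 2 ^ R⌋ % 2 ^ R := by
  have hnonneg : 0 ≤ Int.fract y * 2 ^ R := mul_nonneg (Int.fract_nonneg y) (by positivity)
  have hlt : Int.fract y * 2 ^ R < 2 ^ R :=
    mul_lt_of_lt_one_left (by positivity) (Int.fract_lt_one y)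
  have hfl : ⌊y * 2 ^ R⌋ = ⌊Int.fract y * 2 ^ R⌋ + 2 ^ R * ⌊y⌋ := by
    rw [← Int.floor_add_intCast]
    congr 1
    push_cast
    rw [← Int.self_sub_floor]
    ring
  rw [hfl, Int.add_mul_emod_self_left, Int.natCast_floor_eq_floor hnonneg,
    Int.emod_eq_of_lt (Int.floor_nonneg.2 hnonneg)]
  rw [Int.floor_lt]
  exact_mod_cast hlt

/-- The positive part of the approximation to `2 ^ R` times the second coordinate of a point. -/
def ordinatePos (a M₁ R j u P z : ℕ) : ℕ :=
  M₁ * u + a * P * 2 ^ (R - j ^ 2) + u * P / 2 ^ j ^ 2 + weightedDigitSum negNumerator R j P + z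

/-- The negative part of the approximation to `2 ^ R` times the second coordinate of a point. -/
def ordinateNeg (b M₂ C k R j u P : ℕ) : ℕ :=
  M₂ * u + b * P * 2 ^ (R - j ^ 2) + weightedDigitSum posNumerator R j P +
    C * 2 ^ (R - (k + j ^ 2))

/-- The first `R` binary digits of the second coordinate of a point of the line, computed from
the first `R` binary digits `u` of the first coordinate and the advice `p`. -/
def ordinateDigits (a b M₁ M₂ C k R j u p : ℕ) : ℕ :=
  (ordinatePos a M₁ R j u (p % 2 ^ j ^ 2) (p / 2 ^ j ^ 2) +
    ordinateNeg b M₂ C k R j u (p % 2 ^ j ^ 2) * (2 ^ R - 1)) % 2 ^ R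

theorem natCast_ordinateDigits (a b M₁ M₂ C k R j u p : ℕ) :
    (ordinateDigits a b M₁ M₂ C k R j u p : ℤ) =
      ((ordinatePos a M₁ R j u (p % 2 ^ j ^ 2) (p / 2 ^ j ^ 2) : ℤ) -
        ordinateNeg b M₂ C k R j u (p % 2 ^ j ^ 2)) % 2 ^ R := by
  rw [ordinateDigits]
  set A := ordinatePos a M₁ R j u (p % 2 ^ j ^ 2) (p / 2 ^ j ^ 2)
  set B := ordinateNeg b M₂ C k R j u (p % 2 ^ j ^ 2)
  rw [Int.natCast_mod]
  push_cast [Nat.one_le_two_pow]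
  rw [show (A : ℤ) + B * (2 ^ R - 1) = A - B + 2 ^ R * B by ring, Int.add_mul_emod_self_left]

theorem Int.toNat_sub_toNat_neg_real (z : ℤ) : ((z.toNat : ℝ) - (-z).toNat) = z := by
  exact_mod_cast Int.toNat_sub_toNat_neg z

/-- The intercept of the line of slope `μ`. -/
noncomputable def lineIntercept (μ : ℝ) : ℝ := digitIntercept dyadicOfCode (Int.fract μ)

theorem abs_line_sub_approx_le (μ x : ℝ) {a b k R j u P : ℕ}
    (ha : a = ⌊x⌋.toNat) (hb : b = (-⌊x⌋).toNat) (hu : u = ⌊Int.fract x * 2 ^ R⌋₊)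
    (hj : j = dyadicCode a b k (u / 2 ^ (R - k))) (hR : j ^ 2 + j ≤ R)
    (hP : P = ⌊Int.fract μ * 2 ^ j ^ 2⌋₊) :
    |(μ * x + lineIntercept μ) * 2 ^ R - ⌊μ⌋ * ⌊x⌋ * 2 ^ R -
      (⌊μ⌋ * u + (a - b) * P * 2 ^ (R - j ^ 2) + (u * P / 2 ^ j ^ 2 : ℕ) +
        weightedDigitSum negNumerator R j P - weightedDigitSum posNumerator R j P)| ≤
      |(⌊μ⌋ : ℝ)| + 2 + (2 * |x| + 5) * 2 ^ (R - (k + j ^ 2)) := by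
  have hkj : k ≤ j := hj ▸ le_dyadicCode _ _ _ _
  have hm₀ := Int.fract_nonneg μ
  have hm₁ := Int.fract_lt_one μ
  have ht₀ := Int.fract_nonneg x
  have hμ := Int.floor_add_fract μ
  have hx := Int.floor_add_fract x
  have hab : (a : ℝ) - b = ⌊x⌋ := by rw [ha, hb, Int.toNat_sub_toNat_neg_real]
  set m := Int.fract μ
  set t := Int.fract x
  have hdist : |x - dyadicOfCode j| ≤ (1 / 2) ^ k := by
    rw [hj, dyadicOfCode_dyadicCode, hu, floor_mul_two_pow_div t (by lia), hab]
    have h₁ := Nat.floor_le (show 0 ≤ t * 2 ^ k by positivity)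
    have h₂ := (Nat.lt_floor_add_one (t * 2 ^ k)).le
    have hdiff : x - (⌊x⌋ + ⌊t * 2 ^ k⌋₊ / 2 ^ k) = (t * 2 ^ k - ⌊t * 2 ^ k⌋₊) / 2 ^ k := by
      field_simp
      linear_combination -2 ^ k * hx
    rw [hdiff, abs_div, abs_of_nonneg (a := (2 : ℝ) ^ k) (by positivity), one_div_pow]
    gcongr
    rw [abs_le]
    constructor <;> linarith
  have hmain := abs_line_sub_sum_le abs_dyadicOfCode_le hm₀ hm₁ hkj hdist
  have hmain' : |2 ^ R * (m * x + lineIntercept μ) -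
      2 ^ R * ∑ i ∈ range j, (x - dyadicOfCode i) * squareDigitValue m i| ≤
      (2 * |x| + 5) * 2 ^ (R - (k + j ^ 2)) := by
    have hpow : (2 : ℝ) ^ R = 2 ^ (R - (k + j ^ 2)) * (2 ^ k * 2 ^ j ^ 2) := by
      rw [← pow_add, ← pow_add, Nat.sub_add_cancel (by lia)]
    rw [← mul_sub, abs_mul, abs_of_nonneg (by positivity)]
    refine (mul_le_mul_of_nonneg_left hmain (by positivity)).trans_eq ?_
    rw [hpow, one_div, inv_pow, inv_pow]
    field_simp
  rw [sum_sub_dyadicOfCode_mul hR hm₁, ← hP] at hmain'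
  have hu₁ : 0 ≤ t * 2 ^ R - u := by
    rw [hu, sub_nonneg]
    exact Nat.floor_le (by positivity)
  have hu₂ : t * 2 ^ R - u ≤ 1 := by
    rw [hu]
    linarith [Nat.lt_floor_add_one (t * 2 ^ R)]
  have hfrac : (P : ℝ) / 2 ^ j ^ 2 ≤ 1 := by
    rw [hP, div_le_one (by positivity)]
    refine (Nat.floor_le (by positivity)).trans ?_
    exact mul_le_of_le_one_left (by positivity) hm₁.le
  have hfrac₀ : (0 : ℝ) ≤ P / 2 ^ j ^ 2 := by positivity
  have hdiv₁ : ((u * P / 2 ^ j ^ 2 : ℕ) : ℝ) ≤ u * (P / 2 ^ j ^ 2) := by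
    rw [← mul_div_assoc]
    exact_mod_cast Nat.cast_div_le (α := ℝ) (m := u * P) (n := 2 ^ j ^ 2)
  have hdiv₂ : (u : ℝ) * (P / 2 ^ j ^ 2) ≤ (u * P / 2 ^ j ^ 2 : ℕ) + 1 := by
    have h := Nat.lt_floor_add_one (((u * P : ℕ) : ℝ) / (2 ^ j ^ 2 : ℕ))
    rw [Nat.floor_div_eq_div] at h
    push_cast at h
    rw [← mul_div_assoc]
    exact h.le
  have hM : |(⌊μ⌋ : ℝ) * (t * 2 ^ R - u)| ≤ |(⌊μ⌋ : ℝ)| := by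
    rw [abs_mul, abs_of_nonneg hu₁]
    exact mul_le_of_le_one_right (abs_nonneg _) hu₂
  have hpow : (2 : ℝ) ^ R = 2 ^ (R - j ^ 2) * 2 ^ j ^ 2 := by
    rw [← pow_add, Nat.sub_add_cancel (by lia)]
  have hprod₁ := mul_nonneg hu₁ hfrac₀
  have hprod₂ : (t * 2 ^ R - u) * (P / 2 ^ j ^ 2) ≤ 1 := mul_le_one₀ hu₂ hfrac₀ hfrac
  have hlast : |(t * 2 ^ R - u) * (P / 2 ^ j ^ 2) +
      (u * (P / 2 ^ j ^ 2) - (u * P / 2 ^ j ^ 2 : ℕ))| ≤ 2 := by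
    rw [abs_le]
    constructor <;> linarith
  have hint : (⌊x⌋ : ℝ) * P * 2 ^ (R - j ^ 2) = 2 ^ R * ⌊x⌋ * (P / 2 ^ j ^ 2) := by
    rw [hpow]
    field_simp
  rw [hab, hint]
  refine le_trans (le_of_eq ?_) ((abs_add_three _ _ _).trans
    (add_le_add (add_le_add hM hlast) hmain'))
  congr 1
  linear_combination -2 ^ R * x * hμ - 2 ^ R * (⌊μ⌋ + P / 2 ^ j ^ 2) * hx

theorem exists_ordinateDigits_eq (μ x : ℝ) {a b C k R j u : ℕ}
    (ha : a = ⌊x⌋.toNat) (hb : b = (-⌊x⌋).toNat) (hu : u = ⌊Int.fract x * 2 ^ R⌋₊)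
    (hj : j = dyadicCode a b k (u / 2 ^ (R - k))) (hR : j ^ 2 + j ≤ R)
    (hC : |(⌊μ⌋ : ℝ)| + 2 * |x| + 8 ≤ C) :
    ∃ p < 2 * C * 2 ^ (R - k), ⌊Int.fract (μ * x + lineIntercept μ) * 2 ^ R⌋₊ =
      ordinateDigits a b ⌊μ⌋.toNat (-⌊μ⌋).toNat C k R j u p := by
  have hkj : k ≤ j := hj ▸ le_dyadicCode _ _ _ _
  set P := ⌊Int.fract μ * 2 ^ j ^ 2⌋₊ with hP
  have hPlt : P < 2 ^ j ^ 2 := by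
    rw [hP, Nat.floor_lt (by positivity)]
    push_cast
    exact mul_lt_of_lt_one_left (by positivity) (Int.fract_lt_one μ)
  have happrox := abs_line_sub_approx_le μ x ha hb hu hj hR hP
  set y := μ * x + lineIntercept μ
  set pos := ordinatePos a ⌊μ⌋.toNat R j u P 0 with hpos
  set neg := ordinateNeg b (-⌊μ⌋).toNat C k R j u P with hneg
  have hcast : (pos : ℝ) - neg = ⌊μ⌋ * u + (a - b) * P * 2 ^ (R - j ^ 2) +
      (u * P / 2 ^ j ^ 2 : ℕ) + weightedDigitSum negNumerator R j P -
      weightedDigitSum posNumerator R j P - C * 2 ^ (R - (k + j ^ 2)) := by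
    rw [hpos, hneg, ordinatePos, ordinateNeg, ← Int.toNat_sub_toNat_neg_real ⌊μ⌋]
    simp only [Nat.cast_add, Nat.cast_mul, Nat.cast_pow, Nat.cast_ofNat, Nat.cast_zero]
    ring
  have hone : (1 : ℝ) ≤ 2 ^ (R - (k + j ^ 2)) := one_le_pow₀ one_le_two
  have herr : |(⌊μ⌋ : ℝ)| + 2 + (2 * |x| + 5) * 2 ^ (R - (k + j ^ 2)) <
      C * 2 ^ (R - (k + j ^ 2)) := by
    nlinarith [abs_nonneg (⌊μ⌋ : ℝ), abs_nonneg x]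
  have hbound := abs_le.1 happrox
  have hlow : 0 ≤ ⌊y * 2 ^ R⌋ - ⌊μ⌋ * ⌊x⌋ * 2 ^ R - (pos - neg) := by
    rw [sub_sub, sub_nonneg, Int.le_floor]
    push_cast
    linarith
  have hupp : ⌊y * 2 ^ R⌋ - ⌊μ⌋ * ⌊x⌋ * 2 ^ R - (pos - neg) < 2 * C * 2 ^ (R - (k + j ^ 2)) := by
    have h := Int.floor_le (y * 2 ^ R)
    have h' : ((⌊y * 2 ^ R⌋ - ⌊μ⌋ * ⌊x⌋ * 2 ^ R - (pos - neg) : ℤ) : ℝ) <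
        (2 * C * 2 ^ (R - (k + j ^ 2)) : ℤ) := by
      push_cast
      linarith
    exact_mod_cast h'
  obtain ⟨z, hz⟩ := Int.eq_ofNat_of_zero_le hlow
  have hzlt : z + 1 ≤ 2 * C * 2 ^ (R - (k + j ^ 2)) := by
    rw [hz] at hupp
    exact_mod_cast hupp
  refine ⟨P + 2 ^ j ^ 2 * z, ?_, ?_⟩
  · have hpow : 2 ^ (R - k) = 2 ^ (R - (k + j ^ 2)) * 2 ^ j ^ 2 := by
      rw [← pow_add]
      congr 1
      lia
    calc P + 2 ^ j ^ 2 * z < 2 ^ j ^ 2 * (z + 1) := by rw [mul_add, mul_one]; lia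
      _ ≤ 2 ^ j ^ 2 * (2 * C * 2 ^ (R - (k + j ^ 2))) := Nat.mul_le_mul_left _ hzlt
      _ = 2 * C * 2 ^ (R - k) := by rw [hpow]; ring
  · zify
    have hmod : (P + 2 ^ j ^ 2 * z) % 2 ^ j ^ 2 = P := by
      rw [Nat.add_mul_mod_self_left, Nat.mod_eq_of_lt hPlt]
    have hdiv : (P + 2 ^ j ^ 2 * z) / 2 ^ j ^ 2 = z := by
      rw [Nat.add_mul_div_left _ _ (by positivity), Nat.div_eq_of_lt hPlt, zero_add]
    have hposz : ordinatePos a ⌊μ⌋.toNat R j u P z = pos + z := rfl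
    rw [natCast_floor_fract_mul, natCast_ordinateDigits, hmod, hdiv, hposz, ← hneg, Nat.cast_add,
      ← Int.add_mul_emod_self_left _ (2 ^ R) (-(⌊μ⌋ * ⌊x⌋))]
    congr 1
    linear_combination hz

theorem Primrec.dyadicCode {α : Type*} [Primcodable α] {a b k i : α → ℕ} (ha : Primrec a)
    (hb : Primrec b) (hk : Primrec k) (hi : Primrec i) :
    Primrec fun q => dyadicCode (a q) (b q) (k q) (i q) :=
  Primrec₂.natPair.comp (Primrec₂.natPair.comp ha hb) (Primrec₂.natPair.comp hk hi)

theorem Primrec.two_pow {α : Type*} [Primcodable α] {f : α → ℕ} (hf : Primrec f) :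
    Primrec fun q => 2 ^ f q :=
  Primrec.nat_pow.comp (Primrec.const 2) hf

theorem Primrec.sq {α : Type*} [Primcodable α] {f : α → ℕ} (hf : Primrec f) :
    Primrec fun q => f q ^ 2 :=
  Primrec.nat_pow.comp hf (Primrec.const 2)

theorem primrec_posNumerator : Primrec posNumerator := by
  have h₁ : Primrec fun j : ℕ => j.unpair.1 := Primrec.fst.comp Primrec.unpair
  have h₂ : Primrec fun j : ℕ => j.unpair.2 := Primrec.snd.comp Primrec.unpair
  have hk := h₁.comp h₂
  exact Primrec.nat_mul.comp
    (Primrec.nat_add.comp (Primrec.nat_mul.comp (h₁.comp h₁) hk.two_pow) (h₂.comp h₂))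
    (Primrec.nat_sub.comp Primrec.id hk).two_pow

theorem primrec_negNumerator : Primrec negNumerator := by
  have h₁ : Primrec fun j : ℕ => j.unpair.1 := Primrec.fst.comp Primrec.unpair
  have h₂ : Primrec fun j : ℕ => j.unpair.2 := Primrec.snd.comp Primrec.unpair
  exact Primrec.nat_mul.comp (h₂.comp h₁) Primrec.id.two_pow

theorem primrec_stagePrecision (a b : ℕ) : Primrec (stagePrecision a b) :=
  (Primrec.succ.comp (Primrec.dyadicCode (Primrec.const a) (Primrec.const b) Primrec.id
    Primrec.id.two_pow)).sq

theorem Primrec.weightedDigitSum {α : Type*} [Primcodable α] {f : ℕ → ℕ} {R j P : α → ℕ}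
    (hf : Primrec f) (hR : Primrec R) (hj : Primrec j) (hP : Primrec P) :
    Primrec fun q => weightedDigitSum f (R q) (j q) (P q) := by
  refine Primrec.sum_range ?_ hj
  have hi : Primrec fun q : α × ℕ => q.2 := Primrec.snd
  have hi2 := (Primrec.succ.comp hi).sq
  exact Primrec.nat_mul.comp (Primrec.nat_mul.comp (hf.comp hi) (Primrec.nat_mod.comp
    (Primrec.nat_div.comp (hP.comp Primrec.fst)
      (Primrec.nat_sub.comp (hj.comp Primrec.fst).sq hi2).two_pow)
    (Primrec.nat_double_succ.comp hi).two_pow))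
    (Primrec.nat_sub.comp (hR.comp Primrec.fst) (Primrec.nat_add.comp hi hi2)).two_pow

theorem Primrec.ordinateDigits {α : Type*} [Primcodable α] (a b M₁ M₂ C : ℕ) {k R j u p : α → ℕ}
    (hk : Primrec k) (hR : Primrec R) (hj : Primrec j) (hu : Primrec u) (hp : Primrec p) :
    Primrec fun q => ordinateDigits a b M₁ M₂ C (k q) (R q) (j q) (u q) (p q) := by
  have hj2 := hj.sq
  have hP := Primrec.nat_mod.comp hp hj2.two_pow
  have hz := Primrec.nat_div.comp hp hj2.two_pow
  have hpow := (Primrec.nat_sub.comp hR hj2).two_pow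
  have hpos := Primrec.nat_add.comp (Primrec.nat_add.comp (Primrec.nat_add.comp (Primrec.nat_add.comp
    (Primrec.nat_mul.comp (Primrec.const M₁) hu)
    (Primrec.nat_mul.comp (Primrec.nat_mul.comp (Primrec.const a) hP) hpow))
    (Primrec.nat_div.comp (Primrec.nat_mul.comp hu hP) hj2.two_pow))
    (primrec_negNumerator.weightedDigitSum hR hj hP)) hz
  have hneg := Primrec.nat_add.comp (Primrec.nat_add.comp (Primrec.nat_add.comp
    (Primrec.nat_mul.comp (Primrec.const M₂) hu)
    (Primrec.nat_mul.comp (Primrec.nat_mul.comp (Primrec.const b) hP) hpow))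
    (primrec_posNumerator.weightedDigitSum hR hj hP))
    (Primrec.nat_mul.comp (Primrec.const C)
      (Primrec.nat_sub.comp hR (Primrec.nat_add.comp hk hj2)).two_pow)
  exact Primrec.nat_mod.comp (Primrec.nat_add.comp hpos (Primrec.nat_mul.comp hneg
    (Primrec.nat_sub.comp hR.two_pow (Primrec.const 1)))) hR.two_pow

theorem not_computablyRandom_of_eq_mul_add_lineIntercept {n : ℕ} {i₀ i₁ : Fin n} (hi : i₀ ≠ i₁)
    {x : Fin n → ℝ} {μ : ℝ} (hx : x i₁ = μ * x i₀ + lineIntercept μ) : ¬ ComputablyRandom x := by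
  obtain ⟨C, hC⟩ := exists_nat_ge (|(⌊μ⌋ : ℝ)| + 2 * |x i₀| + 8)
  set a := ⌊x i₀⌋.toNat with ha
  set b := (-⌊x i₀⌋).toNat with hb
  let R := stagePrecision a b
  let j (k u : ℕ) : ℕ := dyadicCode a b k (u / 2 ^ (R k - k))
  let G (k u p : ℕ) : ℕ := ordinateDigits a b ⌊μ⌋.toNat (-⌊μ⌋).toNat C k (R k) (j k u) u p
  have hRp : Primrec R := primrec_stagePrecision a b
  have hk : Primrec fun q : ℕ × ℕ × ℕ => q.1 := Primrec.fst
  have hu : Primrec fun q : ℕ × ℕ × ℕ => q.2.1 := Primrec.fst.comp Primrec.snd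
  have hp : Primrec fun q : ℕ × ℕ × ℕ => q.2.2 := Primrec.snd.comp Primrec.snd
  have hj : Primrec fun q : ℕ × ℕ × ℕ => j q.1 q.2.1 :=
    (Primrec.const a).dyadicCode (Primrec.const b) hk
      (Primrec.nat_div.comp hu (Primrec.nat_sub.comp (hRp.comp hk) hk).two_pow)
  have hG : Primrec fun q : ℕ × ℕ × ℕ => G q.1 q.2.1 q.2.2 :=
    Primrec.ordinateDigits a b _ _ C hk (hRp.comp hk) hj hu hp
  refine not_computablyRandom_of_forall_exists (R := R) (G := G) (C := 2 * C)
    (le_stagePrecision a b) hRp hG hi fun k => ?_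
  have hlt : ⌊Int.fract (x i₀) * 2 ^ R k⌋₊ / 2 ^ (R k - k) ≤ 2 ^ k := by
    rw [floor_mul_two_pow_div _ (le_stagePrecision a b k)]
    refine Nat.floor_le_of_le ?_
    push_cast
    exact mul_le_of_le_one_left (by positivity) (Int.fract_lt_one _).le
  rw [hx]
  exact exists_ordinateDigits_eq μ (x i₀) ha hb rfl rfl (sq_add_self_le_stagePrecision hlt) hC

end

/-- For every `n ≥ 2` and every (Euclidean) unit vector `e ∈ ℝ^n`
there is a point `p` such that no point of the line `{p + s e : s ∈ ℝ}` is
computably random. -/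
theorem exists_line_missing_computably_random
    (n : ℕ) (hn : 2 ≤ n) (e : Fin n → ℝ) (he : ∑ i, (e i) ^ 2 = 1) :
    ∃ p : Fin n → ℝ, ∀ s : ℝ, ¬ ComputablyRandom (p + s • e) := by
  obtain ⟨i₀, h₀⟩ : ∃ i, e i ≠ 0 := by
    by_contra! h
    simp [h] at he
  have : Nontrivial (Fin n) := Fin.nontrivial_iff_two_le.2 hn
  obtain ⟨i₁, hi⟩ := exists_ne i₀
  refine ⟨Pi.single i₁ (lineIntercept (e i₁ / e i₀)), fun s => ?_⟩
  refine not_computablyRandom_of_eq_mul_add_lineIntercept hi.symm (μ := e i₁ / e i₀) ?_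
  simp only [Pi.add_apply, Pi.single_eq_same, Pi.single_eq_of_ne hi.symm, Pi.smul_apply,
    smul_eq_mul, zero_add]
  field_simp
  ring
end

section
/- Let 1 ≤ m < n and E ⊆ ℝ^n. Suppose there is a computable martingale d on [0,1)^{n−m} such that the set N_E(d) = {y ∈ [0,1)^m : there exists x ∈ ℝ^{n−m} with (x,y) ∈ E^# and d does not succeed at x} has computable measure 0 (as a subset of ℝ^m). Then E has computable measure 0 (as a subset of ℝ^n). Here E^# = [0,1)^n ∩ ⋃_{t∈ℤ^n}(E+t), and points of ℝ^n are identified with pairs (x,y) ∈ ℝ^{n−m} × ℝ^m. -/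
open MeasureTheory Filter

/-! ### Primitive recursive arithmetic -/

theorem Primrec.nat_dvd : PrimrecRel ((· ∣ ·) : ℕ → ℕ → Prop) :=
  (Primrec.eq.comp (Primrec.nat_mod.comp Primrec.snd Primrec.fst) (Primrec.const 0)).of_eq
    fun p => (Nat.dvd_iff_mod_eq_zero (m := p.1) (n := p.2)).symm

theorem Nat.gcd_eq_findGreatest (a b : ℕ) :
    a.gcd b = (a + b).findGreatest (fun d => d ∣ a ∧ d ∣ b) := by
  symm
  rw [Nat.findGreatest_eq_iff]
  refine ⟨?_, fun _ => ⟨Nat.gcd_dvd_left a b, Nat.gcd_dvd_right a b⟩, fun n hn hle hdvd => ?_⟩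
  · rcases Nat.eq_zero_or_pos a with rfl | ha
    · simp
    · exact (Nat.gcd_le_left b ha).trans (Nat.le_add_right _ _)
  · have hpos : 0 < a.gcd b := Nat.gcd_pos_iff.2 (by omega)
    exact (Nat.le_of_dvd hpos (Nat.dvd_gcd hdvd.1 hdvd.2)).not_gt hn

theorem Primrec.nat_gcd : Primrec₂ Nat.gcd := by
  have hR : PrimrecRel fun (p : ℕ × ℕ) (d : ℕ) => d ∣ p.1 ∧ d ∣ p.2 :=
    PrimrecPred.and (Primrec.nat_dvd.comp Primrec.snd (Primrec.fst.comp Primrec.fst))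
      (Primrec.nat_dvd.comp Primrec.snd (Primrec.snd.comp Primrec.fst))
  exact (Primrec.nat_findGreatest (Primrec.nat_add.comp Primrec.fst Primrec.snd) hR).of_eq
    fun p => (Nat.gcd_eq_findGreatest p.1 p.2).symm

theorem Primrec.nat_count {p : ℕ → Prop} [DecidablePred p] (hp : PrimrecPred p) :
    Primrec (Nat.count p) := by
  have hstep : Primrec₂ fun (n c : ℕ) => c + if p n then 1 else 0 :=
    Primrec.nat_add.comp Primrec.snd
      (Primrec.ite (hp.comp Primrec.fst) (Primrec.const 1) (Primrec.const 0))
  refine (Primrec.nat_rec₁ 0 hstep).of_eq fun n => ?_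
  induction n with
  | zero => simp
  | succ n ih => rw [Nat.count_succ, ← ih]

/-- The increasing enumeration of an infinite primitive recursive set is computable. -/
theorem Computable.nat_nth {p : ℕ → Prop} (hp : PrimrecPred p) (hinf : (Set.ofPred p).Infinite) :
    Computable (Nat.nth p) := by
  classical
  have hQ : PrimrecRel fun (a n : ℕ) => p n ∧ Nat.count p n = a :=
    PrimrecPred.and (hp.comp Primrec.snd)
      (Primrec.eq.comp ((Primrec.nat_count hp).comp Primrec.snd) Primrec.fst)
  have hdec : Computable₂ fun a n : ℕ => decide (p n ∧ Nat.count p n = a) :=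
    Primrec.to_comp hQ.decide
  refine (Partrec.rfind hdec.partrec₂).of_eq_tot fun a => ?_
  rw [Nat.mem_rfind]
  refine ⟨?_, fun {m} hm => ?_⟩
  · simp [Nat.nth_mem_of_infinite hinf, Nat.count_nth_of_infinite hinf]
  · suffices ¬ (p m ∧ Nat.count p m = a) by simpa using this
    rintro ⟨hpm, rfl⟩
    rw [Nat.nth_count hpm] at hm
    exact lt_irrefl _ hm

/-! ### Computable arithmetic of rational numbers -/

/-- The code of a rational number as a pair of a coded numerator and a denominator. -/
def Rat.pairCode (q : ℚ) : ℕ := @Encodable.encode ℚ Rat.instEncodable q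

theorem Rat.pairCode_eq (q : ℚ) : q.pairCode = Nat.pair (Equiv.intEquivNat q.num) q.den := rfl

theorem Equiv.intEquivNat_natCast (n : ℕ) : Equiv.intEquivNat (n : ℤ) = 2 * n := rfl

theorem Equiv.intEquivNat_negSucc (n : ℕ) : Equiv.intEquivNat (Int.negSucc n) = 2 * n + 1 := rfl

theorem Equiv.intEquivNat_add_one_div_two (z : ℤ) : (Equiv.intEquivNat z + 1) / 2 = z.natAbs := by
  rcases z with n | n
  · change (2 * n + 1) / 2 = n
    omega
  · rw [Equiv.intEquivNat_negSucc, Int.natAbs_negSucc]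
    omega

theorem Rat.mem_range_pairCode (n : ℕ) :
    n ∈ Set.range Rat.pairCode ↔
      0 < n.unpair.2 ∧ ((n.unpair.1 + 1) / 2).gcd n.unpair.2 = 1 := by
  constructor
  · rintro ⟨q, rfl⟩
    rw [Rat.pairCode_eq, Nat.unpair_pair, Equiv.intEquivNat_add_one_div_two]
    exact ⟨q.pos, q.reduced⟩
  · rintro ⟨hpos, hgcd⟩
    refine ⟨⟨Equiv.intEquivNat.symm n.unpair.1, n.unpair.2, hpos.ne', ?_⟩, ?_⟩
    · rw [← Equiv.intEquivNat_add_one_div_two, Equiv.apply_symm_apply]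
      exact hgcd
    · rw [Rat.pairCode_eq]
      dsimp only
      rw [Equiv.apply_symm_apply, Nat.pair_unpair]

theorem Rat.primrecPred_pairCode : PrimrecPred (· ∈ Set.range Rat.pairCode) := by
  have h1 : Primrec fun n : ℕ => n.unpair.1 := Primrec.fst.comp Primrec.unpair
  have h2 : Primrec fun n : ℕ => n.unpair.2 := Primrec.snd.comp Primrec.unpair
  exact (PrimrecPred.and (Primrec.nat_lt.comp (Primrec.const 0) h2)
    (Primrec.eq.comp (Primrec.nat_gcd.comp
      (Primrec.nat_div.comp (Primrec.succ.comp h1) (Primrec.const 2)) h2) (Primrec.const 1))).of_eq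
    fun n => (Rat.mem_range_pairCode n).symm

theorem Rat.pairCode_injective : Function.Injective Rat.pairCode :=
  @Encodable.encode_injective ℚ Rat.instEncodable

theorem Rat.infinite_range_pairCode : (Set.ofPred (· ∈ Set.range Rat.pairCode)).Infinite :=
  Set.infinite_range_of_injective Rat.pairCode_injective

theorem Rat.pairCode_ofNat (n : ℕ) :
    (Denumerable.ofNat ℚ n).pairCode = Nat.nth (· ∈ Set.range Rat.pairCode) n := by
  let : DecidablePred (· ∈ Set.range Rat.pairCode) := @Encodable.decidableRangeEncode ℚ _
  have : Infinite (Set.range Rat.pairCode) := Rat.infinite_range_pairCode.to_subtype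
  have hcode (n : ℕ) : (Denumerable.ofNat ℚ n).pairCode =
      (Nat.Subtype.ofNat (Set.range Rat.pairCode) n : ℕ) := by
    let := Nat.Subtype.denumerable (Set.range Rat.pairCode)
    have h : Denumerable.ofNat ℚ n = (@Encodable.equivRangeEncode ℚ Rat.instEncodable).symm
        (Nat.Subtype.ofNat (Set.range Rat.pairCode) n) :=
      (Denumerable.ofEquiv_ofNat (Set.range Rat.pairCode)
        (@Encodable.equivRangeEncode ℚ Rat.instEncodable) n)
    rw [h]
    exact congrArg Subtype.val ((@Encodable.equivRangeEncode ℚ Rat.instEncodable).apply_symm_apply _)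
  have hmono : StrictMono fun n => (Denumerable.ofNat ℚ n).pairCode := by
    refine strictMono_nat_of_lt_succ fun n => ?_
    rw [hcode, hcode]
    exact Nat.Subtype.lt_succ_self _
  have hrange : Set.range (fun n => (Denumerable.ofNat ℚ n).pairCode) =
      Set.range (Nat.nth (· ∈ Set.range Rat.pairCode)) := by
    rw [Nat.range_nth_of_infinite Rat.infinite_range_pairCode]
    exact (Denumerable.eqv ℚ).symm.surjective.range_comp Rat.pairCode
  exact congrFun ((StrictMono.range_inj hmono
    (Nat.nth_strictMono Rat.infinite_range_pairCode)).1 hrange) n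

theorem Rat.computable_pairCode : Computable Rat.pairCode :=
  ((Computable.nat_nth Rat.primrecPred_pairCode Rat.infinite_range_pairCode).comp
    Computable.encode).of_eq fun q => by
      rw [← Rat.pairCode_ofNat, Denumerable.ofNat_encode]

theorem Rat.computable_natAbs_num : Computable fun q : ℚ => q.num.natAbs :=
  ((Primrec.nat_div.comp (Primrec.succ.comp (Primrec.fst.comp Primrec.unpair))
    (Primrec.const 2)).to_comp.comp Rat.computable_pairCode).of_eq fun q => by
      rw [Rat.pairCode_eq, Nat.unpair_pair]
      exact Equiv.intEquivNat_add_one_div_two q.num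

theorem Rat.computable_den : Computable fun q : ℚ => q.den :=
  ((Primrec.snd.comp Primrec.unpair).to_comp.comp Rat.computable_pairCode).of_eq fun q => by
    rw [Rat.pairCode_eq, Nat.unpair_pair]

theorem Computable.rat_of_pairCode {α : Type*} [Primcodable α] {f : α → ℚ}
    (hf : Computable fun a => (f a).pairCode) : Computable f := by
  classical
  refine (((Computable.ofNat ℚ).comp (Primrec.nat_count Rat.primrecPred_pairCode).to_comp).comp
    hf).of_eq fun a => ?_
  have h := Rat.pairCode_ofNat (Nat.count (· ∈ Set.range Rat.pairCode) (f a).pairCode)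
  rw [Nat.nth_count (p := (· ∈ Set.range Rat.pairCode)) ⟨f a, rfl⟩] at h
  exact Rat.pairCode_injective h

theorem Rat.computable₂_natCast_div_succ : Computable₂ fun a b : ℕ => (a : ℚ) / (b + 1 : ℕ) := by
  refine Computable.rat_of_pairCode ?_
  have hs : Primrec₂ fun _ b : ℕ => b + 1 := Primrec.succ.comp Primrec.snd
  have hg : Primrec₂ fun a b : ℕ => a.gcd (b + 1) := Primrec.nat_gcd.comp Primrec.fst hs
  have hcode : Primrec₂ fun a b : ℕ =>
      Nat.pair (2 * (a / a.gcd (b + 1))) ((b + 1) / a.gcd (b + 1)) :=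
    Primrec₂.natPair.comp
      (Primrec.nat_mul.comp (Primrec.const 2) (Primrec.nat_div.comp Primrec.fst hg))
      (Primrec.nat_div.comp hs hg)
  refine (Primrec.to_comp hcode).of_eq fun p => ?_
  have hq : (p.1 : ℚ) / (p.2 + 1 : ℕ) = mkRat p.1 (p.2 + 1) := by
    rw [Rat.mkRat_eq_div, Int.cast_natCast]
  change _ = Rat.pairCode ((p.1 : ℚ) / (p.2 + 1 : ℕ))
  rw [hq, Rat.pairCode_eq, Rat.num_mkRat, Rat.den_mkRat, if_neg p.2.succ_ne_zero,
    if_neg p.2.succ_ne_zero, Int.natAbs_natCast, Nat.gcd_comm (p.2 + 1), ← Int.natCast_ediv,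
    Equiv.intEquivNat_natCast]

theorem Computable.rat_add_of_nonneg {α : Type*} [Primcodable α] {f g : α → ℚ}
    (hf : Computable f) (hg : Computable g) (hf0 : ∀ a, 0 ≤ f a) (hg0 : ∀ a, 0 ≤ g a) :
    Computable fun a => f a + g a := by
  have hmul := Primrec.nat_mul.to_comp
  have hfn := Rat.computable_natAbs_num.comp hf
  have hgn := Rat.computable_natAbs_num.comp hg
  have hfd := Rat.computable_den.comp hf
  have hgd := Rat.computable_den.comp hg
  refine (Rat.computable₂_natCast_div_succ.comp
    (Primrec.nat_add.to_comp.comp (hmul.comp hfn hgd) (hmul.comp hgn hfd))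
    (Computable.pred.comp (hmul.comp hfd hgd))).of_eq fun a => ?_
  have hpos : 0 < (f a).den * (g a).den := Nat.mul_pos (f a).pos (g a).pos
  have hnum (q : ℚ) (hq : 0 ≤ q) : ((q.num.natAbs : ℕ) : ℚ) / q.den = q := by
    have : ((q.num.natAbs : ℕ) : ℤ) = q.num := Int.natAbs_of_nonneg (Rat.num_nonneg.2 hq)
    rw [← Int.cast_natCast, this, Rat.num_div_den]
  rw [Nat.pred_eq_sub_one, Nat.sub_add_cancel hpos]
  conv_rhs => rw [← hnum _ (hf0 a), ← hnum _ (hg0 a)]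
  have h1 : ((f a).den : ℚ) ≠ 0 := Nat.cast_ne_zero.2 (f a).den_nz
  have h2 : ((g a).den : ℚ) ≠ 0 := Nat.cast_ne_zero.2 (g a).den_nz
  push_cast
  field_simp

/-! ### The sum martingale on a product of cubes -/

theorem Primrec.precomp_fin {α : Type*} [Primcodable α] {i j : ℕ} (e : Fin i → Fin j) :
    Primrec fun (w : Fin j → α) (l : Fin i) => w (e l) :=
  Primrec.fin_curry.2 (Primrec.fin_app.comp Primrec.fst ((Primrec.dom_finite e).comp Primrec.snd))

theorem Fintype.sum_comp_castAdd (k m : ℕ) (F : (Fin k → Bool) → ℝ) :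
    ∑ a : Fin (k + m) → Bool, F (fun i => a (Fin.castAdd m i)) = 2 ^ m * ∑ b, F b := by
  rw [← (Fin.appendEquiv k m).sum_comp, Fintype.sum_prod_type]
  simp [Fin.appendEquiv, Finset.mul_sum]

theorem Fintype.sum_comp_natAdd (k m : ℕ) (F : (Fin m → Bool) → ℝ) :
    ∑ a : Fin (k + m) → Bool, F (fun i => a (Fin.natAdd k i)) = 2 ^ k * ∑ b, F b := by
  rw [← (Fin.appendEquiv k m).sum_comp, Fintype.sum_prod_type]
  simp [Fin.appendEquiv]

namespace DyadicMartingale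

variable {k m : ℕ}

/-- The martingale `(x, y) ↦ d x + d' y` on a product of cubes. -/
def prodAdd (d : DyadicMartingale k) (d' : DyadicMartingale m) : DyadicMartingale (k + m) where
  toFun r w := d.toFun r (fun i => w (Fin.castAdd m i)) + d'.toFun r (fun i => w (Fin.natAdd k i))
  nonneg r w := add_nonneg (d.nonneg r _) (d'.nonneg r _)
  fair r w hw := by
    rw [d.fair r _ fun i => hw (Fin.castAdd m i), d'.fair r _ fun i => hw (Fin.natAdd k i),
      Finset.sum_add_distrib,
      Fintype.sum_comp_castAdd k m fun b =>
        d.toFun (r + 1) fun i => 2 * w (Fin.castAdd m i) + if b i then 1 else 0,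
      Fintype.sum_comp_natAdd k m fun b =>
        d'.toFun (r + 1) fun i => 2 * w (Fin.natAdd k i) + if b i then 1 else 0]
    simp only [zpow_neg, zpow_natCast, pow_add]
    field_simp

theorem IsComputable.prodAdd {d : DyadicMartingale k} {d' : DyadicMartingale m}
    (hd : d.IsComputable) (hd' : d'.IsComputable) : (d.prodAdd d').IsComputable := by
  obtain ⟨f, hf, hf0, hfd⟩ := hd
  obtain ⟨g, hg, hg0, hgd⟩ := hd'
  have hs : Primrec fun p : ℕ × ℕ × (Fin (k + m) → ℤ) => p.1 + 1 := Primrec.succ.comp Primrec.fst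
  have hr : Primrec fun p : ℕ × ℕ × (Fin (k + m) → ℤ) => p.2.1 := Primrec.fst.comp Primrec.snd
  have hw : Primrec fun p : ℕ × ℕ × (Fin (k + m) → ℤ) => p.2.2 := Primrec.snd.comp Primrec.snd
  refine ⟨fun p => f (p.1 + 1, p.2.1, fun i => p.2.2 (Fin.castAdd m i)) +
      g (p.1 + 1, p.2.1, fun i => p.2.2 (Fin.natAdd k i)),
    Computable.rat_add_of_nonneg
      (hf.comp (hs.pair (hr.pair ((Primrec.precomp_fin (Fin.castAdd m)).comp hw))).to_comp)
      (hg.comp (hs.pair (hr.pair ((Primrec.precomp_fin (Fin.natAdd k)).comp hw))).to_comp)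
      (fun _ => hf0 _) (fun _ => hg0 _),
    fun _ => add_nonneg (hf0 _) (hg0 _), fun s r w hv => ?_⟩
  have h1 := hfd (s + 1) r _ fun i => hv (Fin.castAdd m i)
  have h2 := hgd (s + 1) r _ fun i => hv (Fin.natAdd k i)
  have h3 : (2 : ℝ) ^ (-((s + 1 : ℕ) : ℤ)) + 2 ^ (-((s + 1 : ℕ) : ℤ)) = 2 ^ (-(s : ℤ)) := by
    simp only [zpow_neg, zpow_natCast, pow_succ]
    field_simp
    norm_num
  rw [← h3]
  refine le_trans (le_of_eq_of_le ?_ (abs_add_le _ _)) (add_le_add h1 h2)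
  simp only [DyadicMartingale.prodAdd, Rat.cast_add]
  congr 1
  ring

end DyadicMartingale

theorem succeedsAt.mono {n l : ℕ} {d : DyadicMartingale n} {D : DyadicMartingale l}
    {x : Fin n → ℝ} {z : Fin l → ℝ} (h : succeedsAt d x)
    (hle : ∀ r, d.toFun r (dyadicIndex n r x) ≤ D.toFun r (dyadicIndex l r z)) :
    succeedsAt D z := by
  unfold succeedsAt at h ⊢
  rw [← top_le_iff, ← h]
  exact Filter.limsup_le_limsup (Filter.Eventually.of_forall fun r => EReal.coe_le_coe_iff.2 (hle r))

theorem mem_sharp_of_mem {n : ℕ} {E : Set (Fin n → ℝ)} {x : Fin n → ℝ} (hx : x ∈ E)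
    (hcube : x ∈ unitCube n) : x ∈ sharp E :=
  ⟨hcube, Set.mem_iUnion.2 ⟨0, x, hx, by ext; simp⟩⟩

/-- computable Fubini. Let `1 ≤ k`, `1 ≤ m`, and `E ⊆ ℝ^{k+m}`
(with points written `(x,y) ∈ ℝ^k × ℝ^m` via `Fin.append`). If `d` is a computable
martingale on `[0,1)^k` such that
`N_E(d) = {y ∈ [0,1)^m | ∃ x ∈ E^#_y, d does not succeed at x}` has computable
measure 0 in `ℝ^m`, then `E` has computable measure 0 in `ℝ^{k+m}`. -/
theorem computable_fubini
    (k m : ℕ) (hk : 1 ≤ k) (hm : 1 ≤ m) (E : Set (Fin (k + m) → ℝ))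
    (d : DyadicMartingale k) (hd : d.IsComputable)
    (hN : HasComputableMeasureZero
      {y : Fin m → ℝ | (∀ i, 0 ≤ y i ∧ y i < 1) ∧
        ∃ x : Fin k → ℝ, Fin.append x y ∈ sharp E ∧ ¬ succeedsAt d x}) :
    HasComputableMeasureZero E := by
  obtain ⟨d', hd', hsucc⟩ := hN
  refine ⟨d.prodAdd d', hd.prodAdd hd', fun z hz => ?_⟩
  by_cases hx : succeedsAt d fun i => z (Fin.castAdd m i)
  · exact hx.mono fun r => le_add_of_nonneg_right (d'.nonneg r _)
  · have hcube : (fun i => z (Fin.natAdd k i)) ∈ unitCube m := fun i => hz.1 (Fin.natAdd k i)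
    have hy := hsucc (fun i => z (Fin.natAdd k i)) <| mem_sharp_of_mem
      ⟨hcube, _, by rwa [Fin.append_castAdd_natAdd], hx⟩ hcube
    exact hy.mono fun r => le_add_of_nonneg_left (d.nonneg r _)
end
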